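/- arXiv:0903.4358 — 5 statements merged into one kernel-verified Lean document; each statement's English description precedes it below -/
import Mathlib

section
/- Define a sequence of real polynomials recursively by G_0(x) = x and, for p ≥ 1, G_p(x) = p·∫₀ˣ G_{p-1}(t) dt + (1 − p·∫₀¹ G_{p-1}(t) dt)·x. Then for every p ∈ ℕ and every positive integer n, G_p(n) = 1^p + 2^p + ⋯ + n^p. -/
open MeasureTheory intervalIntegral

/-- The sequence of functions defined by `G_0(x) = x` and, for `p ≥ 1`,
`G_p(x) = p·∫₀ˣ G_{p-1}(t) dt + (1 − p·∫₀¹ G_{p-1}(t) dt)·x`. -/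
noncomputable def G : ℕ → ℝ → ℝ
  | 0 => fun x => x
  | (p + 1) => fun x =>
      ((p : ℝ) + 1) * (∫ t in (0:ℝ)..x, G p t) +
        (1 - ((p : ℝ) + 1) * ∫ t in (0:ℝ)..(1:ℝ), G p t) * x

theorem continuous_G (p : ℕ) : Continuous (G p) := by
  induction p with
  | zero => exact continuous_id
  | succ p ih =>
    have h : Continuous fun x : ℝ => ∫ t in (0:ℝ)..x, G p t :=
      intervalIntegral.continuous_primitive (fun a b => ih.intervalIntegrable a b) 0
    simp only [G]
    fun_prop

theorem G_zero_right (p : ℕ) : G p 0 = 0 := by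
  cases p <;> simp [G]

theorem G_add_one_sub (p : ℕ) (x : ℝ) : G p (x + 1) - G p x = (x + 1) ^ p := by
  induction p generalizing x with
  | zero => simp [G]
  | succ p ih =>
    have hc := continuous_G p
    have hint (a b : ℝ) : IntervalIntegrable (G p) volume a b := hc.intervalIntegrable a b
    have hshift : (∫ t in (0:ℝ)..x, G p (t + 1)) = ∫ t in (1:ℝ)..(x + 1), G p t := by
      rw [intervalIntegral.integral_comp_add_right (G p) 1, zero_add]
    have hdiff : (∫ t in (1:ℝ)..(x + 1), G p t) - (∫ t in (0:ℝ)..x, G p t) =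
        ((x + 1) ^ (p + 1) - 1) / ((p : ℝ) + 1) := by
      rw [← hshift, ← intervalIntegral.integral_sub
        ((by fun_prop : Continuous fun t => G p (t + 1)).intervalIntegrable _ _) (hint _ _)]
      simp only [ih]
      rw [intervalIntegral.integral_comp_add_right (fun t : ℝ => t ^ p) 1, integral_pow]
      simp
    have hadd := intervalIntegral.integral_add_adjacent_intervals (hint 0 1) (hint 1 (x + 1))
    have hp : (p : ℝ) + 1 ≠ 0 := by positivity
    rw [eq_div_iff hp] at hdiff
    simp only [G]
    rw [← hadd]
    linear_combination hdiff

theorem G_eval_sum_powers (p : ℕ) (n : ℕ) (hn : 1 ≤ n) :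
    G p (n : ℝ) = ∑ k ∈ Finset.Icc 1 n, (k : ℝ) ^ p := by
  induction n, hn using Nat.le_induction with
  | base => simpa [G_zero_right] using G_add_one_sub p 0
  | succ n hn ih =>
    rw [Finset.sum_Icc_succ_top (by lia), ← ih]
    push_cast
    linear_combination G_add_one_sub p n
end

section
/- For every natural number i ≥ 1 and every integer j with 2 ≤ j ≤ i+1, the coefficient of x^j in the Faulhaber polynomial F_i equals (i/j) times the coefficient of x^{j-1} in F_{i-1}. -/
/-- The Faulhaber polynomial `F_p(x) = (1/(p+1))·(B_{p+1}(x+1) − B_{p+1}(0))`,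
as a real polynomial. -/
noncomputable def faulhaberPoly (p : ℕ) : Polynomial ℝ :=
  Polynomial.C (1 / (p + 1 : ℝ)) *
    (((Polynomial.bernoulli (p + 1)).map (algebraMap ℚ ℝ)).comp (Polynomial.X + 1) -
      Polynomial.C (((Polynomial.bernoulli (p + 1)).map (algebraMap ℚ ℝ)).eval 0))

/-- The derivative of `F_{p+1}` is `(p+1)·F_p + B_{p+1}(0)`. -/
theorem derivative_faulhaberPoly_succ (p : ℕ) :
    Polynomial.derivative (faulhaberPoly (p + 1)) =
      Polynomial.C (p + 1 : ℝ) * faulhaberPoly p +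
        Polynomial.C (((Polynomial.bernoulli (p + 1)).map (algebraMap ℚ ℝ)).eval 0) := by
  have hp : (p + 1 : ℝ) ≠ 0 := by positivity
  have hp₂ : (p + 1 + 1 : ℝ) ≠ 0 := by positivity
  have hder : Polynomial.derivative
      (((Polynomial.bernoulli (p + 1 + 1)).map (algebraMap ℚ ℝ)).comp (Polynomial.X + 1)) =
        Polynomial.C (p + 1 + 1 : ℝ) *
          ((Polynomial.bernoulli (p + 1)).map (algebraMap ℚ ℝ)).comp (Polynomial.X + 1) := by
    rw [Polynomial.derivative_comp, Polynomial.derivative_map,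
      Polynomial.derivative_bernoulli_add_one]
    simp
  unfold faulhaberPoly
  rw [Polynomial.derivative_C_mul, Polynomial.derivative_sub, Polynomial.derivative_C, sub_zero,
    hder, ← mul_assoc, ← mul_assoc, ← Polynomial.C_mul, ← Polynomial.C_mul]
  push_cast
  rw [one_div_mul_cancel hp₂, mul_one_div_cancel hp]
  simp

theorem faulhaber_coeff_recurrence (i : ℕ) (hi : 1 ≤ i) (j : ℕ) (hj2 : 2 ≤ j)
    (hji : j ≤ i + 1) :
    (faulhaberPoly i).coeff j = ((i : ℝ) / (j : ℝ)) * (faulhaberPoly (i - 1)).coeff (j - 1) := by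
  obtain ⟨k, rfl⟩ := Nat.exists_eq_add_of_le' hi
  obtain ⟨m, rfl⟩ := Nat.exists_eq_add_of_le' hj2
  have h := congrArg (fun q => q.coeff (m + 1)) (derivative_faulhaberPoly_succ k)
  simp only [Polynomial.coeff_derivative, Polynomial.coeff_add, Polynomial.coeff_C_mul,
    Polynomial.coeff_C_succ, add_zero] at h
  have hm : ((m + 2 : ℕ) : ℝ) ≠ 0 := by positivity
  rw [div_mul_eq_mul_div, eq_div_iff hm]
  convert h using 2 <;> push_cast <;> ring
end

section
/- For every natural number p ≥ 1 and every real number x ≥ 0, one has p·∫₀ˣ F_{p-1}(t) dt = (1/(p+1))·(B_{p+1}(x+1) − B_{p+1}(1)) − x·B_p(0). -/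
open MeasureTheory intervalIntegral

/-- The `k`-th Bernoulli polynomial, as a function `ℝ → ℝ`. -/
noncomputable def bernoulliPolyFun (k : ℕ) (x : ℝ) : ℝ :=
  ((Polynomial.bernoulli k).map (algebraMap ℚ ℝ)).eval x

/-- The Faulhaber polynomial `F_p(x) = (1/(p+1))·(B_{p+1}(x+1) − B_{p+1}(0))`. -/
noncomputable def faulhaberFun (p : ℕ) (x : ℝ) : ℝ :=
  (1 / (p + 1 : ℝ)) * (bernoulliPolyFun (p + 1) (x + 1) - bernoulliPolyFun (p + 1) 0)

theorem bernoulliPolyFun_eq_bernoulliFun : bernoulliPolyFun = bernoulliFun := rfl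

theorem integral_bernoulliFun_add_one (k : ℕ) (a b : ℝ) :
    ∫ t in a..b, bernoulliFun k (t + 1) =
      (bernoulliFun (k + 1) (b + 1) - bernoulliFun (k + 1) (a + 1)) / (k + 1) := by
  rw [integral_comp_add_right (bernoulliFun k), integral_eq_sub_of_hasDerivAt
    (fun t _ => antideriv_bernoulliFun k t) (intervalIntegrable_bernoulliFun k _ _), sub_div]

theorem natCast_succ_mul_faulhaberFun (q : ℕ) (t : ℝ) :
    ((q + 1 : ℕ) : ℝ) * faulhaberFun q t =
      bernoulliFun (q + 1) (t + 1) - bernoulliFun (q + 1) 0 := by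
  rw [faulhaberFun, bernoulliPolyFun_eq_bernoulliFun]
  push_cast
  field_simp

theorem integral_faulhaber_eq (p : ℕ) (hp : 1 ≤ p) (x : ℝ) (hx : 0 ≤ x) :
    (p : ℝ) * ∫ t in (0:ℝ)..x, faulhaberFun (p - 1) t =
      (1 / (p + 1 : ℝ)) * (bernoulliPolyFun (p + 1) (x + 1) - bernoulliPolyFun (p + 1) 1) -
        x * bernoulliPolyFun p 0 := by
  obtain ⟨q, rfl⟩ := Nat.exists_eq_add_of_le' hp
  have hint : IntervalIntegrable (fun t => bernoulliFun (q + 1) (t + 1)) volume 0 x :=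
    ((continuous_bernoulliFun (q + 1)).comp (continuous_add_const 1)).intervalIntegrable 0 x
  rw [← intervalIntegral.integral_const_mul]
  simp only [Nat.add_sub_cancel, natCast_succ_mul_faulhaberFun, bernoulliPolyFun_eq_bernoulliFun]
  rw [intervalIntegral.integral_sub hint intervalIntegrable_const, integral_bernoulliFun_add_one,
    intervalIntegral.integral_const,
    zero_add, sub_zero, smul_eq_mul]
  ring
end

section
/- For every natural number p ≥ 1 and every real number x ≥ 0, p·∫₀ˣ F_{p-1}(t) dt + (1 − p·∫₀¹ F_{p-1}(t) dt)·x = (1/(p+1))·(B_{p+1}(x+1) − B_{p+1}(0)). -/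
open MeasureTheory intervalIntegral

theorem hasDerivAt_bernoulliPolyFun (k : ℕ) (x : ℝ) :
    HasDerivAt (bernoulliPolyFun k) (k * bernoulliPolyFun (k - 1) x) x :=
  hasDerivAt_bernoulliFun k x

theorem continuous_faulhaberFun (p : ℕ) : Continuous (faulhaberFun p) := by
  have h : Continuous (bernoulliPolyFun (p + 1)) := continuous_bernoulliFun (p + 1)
  unfold faulhaberFun
  fun_prop

theorem faulhaberFun_zero {p : ℕ} (hp : p ≠ 0) : faulhaberFun p 0 = 0 := by
  have h : bernoulliPolyFun (p + 1) 1 = bernoulliPolyFun (p + 1) 0 :=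
    bernoulliFun_endpoints_eq_of_ne_one (by simpa using hp)
  simp [faulhaberFun, h]

theorem bernoulliPolyFun_two (k : ℕ) :
    bernoulliPolyFun k 2 = bernoulliPolyFun k 1 + k := by
  have h := congrArg (algebraMap ℚ ℝ) (Polynomial.bernoulli_eval_one_add k 1)
  rw [show (1 + 1 : ℚ) = 2 by norm_num, one_pow, mul_one, map_add,
    ← Polynomial.eval_map_apply, ← Polynomial.eval_map_apply] at h
  simpa [bernoulliPolyFun] using h

theorem faulhaberFun_one {p : ℕ} (hp : p ≠ 0) : faulhaberFun p 1 = 1 := by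
  have h : bernoulliPolyFun (p + 1) 1 = bernoulliPolyFun (p + 1) 0 :=
    bernoulliFun_endpoints_eq_of_ne_one (by simpa using hp)
  have hp' : (p + 1 : ℝ) ≠ 0 := by positivity
  rw [faulhaberFun, show (1 + 1 : ℝ) = 2 by norm_num, bernoulliPolyFun_two, h]
  push_cast
  field_simp
  ring

theorem hasDerivAt_faulhaberFun (p : ℕ) (x : ℝ) :
    HasDerivAt (faulhaberFun (p + 1))
      ((p + 1) * faulhaberFun p x + bernoulliPolyFun (p + 1) 0) x := by
  have h := (((hasDerivAt_bernoulliPolyFun (p + 1 + 1) (x + 1)).comp_add_const x 1).sub_const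
    (bernoulliPolyFun (p + 1 + 1) 0)).const_mul (1 / ((p + 1 : ℕ) + 1 : ℝ))
  refine h.congr_deriv ?_
  have h₁ : (p + 1 : ℝ) ≠ 0 := by positivity
  have h₂ : (p + 1 + 1 : ℝ) ≠ 0 := by positivity
  simp only [faulhaberFun, Nat.add_sub_cancel]
  push_cast
  field_simp
  ring

theorem integral_faulhaberFun (p : ℕ) (x : ℝ) :
    (p + 1 : ℝ) * ∫ t in (0:ℝ)..x, faulhaberFun p t =
      faulhaberFun (p + 1) x - bernoulliPolyFun (p + 1) 0 * x := by
  have hc := continuous_faulhaberFun p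
  have h := integral_eq_sub_of_hasDerivAt (a := 0) (b := x)
    (fun t _ => hasDerivAt_faulhaberFun p t)
    (Continuous.intervalIntegrable (by fun_prop) 0 x)
  rw [integral_add (Continuous.intervalIntegrable (by fun_prop) _ _) (by simp),
    intervalIntegral.integral_const_mul, intervalIntegral.integral_const,
    faulhaberFun_zero p.succ_ne_zero, smul_eq_mul] at h
  linarith

theorem faulhaber_recurrence_combined (p : ℕ) (hp : 1 ≤ p) (x : ℝ) (hx : 0 ≤ x) :
    (p : ℝ) * (∫ t in (0:ℝ)..x, faulhaberFun (p - 1) t) +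
        (1 - (p : ℝ) * ∫ t in (0:ℝ)..(1:ℝ), faulhaberFun (p - 1) t) * x =
      (1 / (p + 1 : ℝ)) * (bernoulliPolyFun (p + 1) (x + 1) - bernoulliPolyFun (p + 1) 0) := by
  obtain ⟨p, rfl⟩ := Nat.exists_eq_add_of_le' hp
  change _ = faulhaberFun (p + 1) x
  simp only [Nat.add_sub_cancel, Nat.cast_add, Nat.cast_one]
  rw [integral_faulhaberFun, integral_faulhaberFun, faulhaberFun_one p.succ_ne_zero]
  ring
end

section
/- Define a doubly indexed family of rationals by a_{(0,1)} = 1, a_{(0,j)} = 0 for j ≠ 1, and for i ≥ 1: a_{(i,j)} = (i/j)·a_{(i-1,j-1)} for 2 ≤ j ≤ i+1, a_{(i,j)} = 0 for j = 0 or j > i+1, and a_{(i,1)} = 1 − ∑_{j=2}^{i+1} a_{(i,j)}. Then for every p ∈ ℕ and every positive integer n, ∑_{j=1}^{p+1} a_{(p,j)}·n^j = 1^p + 2^p + ⋯ + n^p. -/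
/-- The doubly indexed family of rationals from the direct algorithm:
`a 0 1 = 1`, `a 0 j = 0` for `j ≠ 1`; for `i ≥ 1`,
`a i j = (i/j)·a (i-1) (j-1)` when `2 ≤ j ≤ i+1`, `a i j = 0` when `j = 0` or
`j > i+1`, and `a i 1 = 1 − ∑_{j=2}^{i+1} a i j`. -/
def faulhaberCoeff : ℕ → ℕ → ℚ
  | 0, j => if j = 1 then 1 else 0
  | (i + 1), j =>
      if j = 1 then
        1 - ∑ k ∈ Finset.Icc 2 (i + 2), ((i + 1 : ℚ) / (k : ℚ)) * faulhaberCoeff i (k - 1)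
      else if 2 ≤ j ∧ j ≤ i + 2 then
        ((i + 1 : ℚ) / (j : ℚ)) * faulhaberCoeff i (j - 1)
      else 0

theorem sum_Icc_pow_eq_sum_bernoulli' (p n : ℕ) :
    ∑ k ∈ Finset.Icc 1 n, (k : ℚ) ^ p =
      ∑ j ∈ Finset.Icc 1 (p + 1),
        bernoulli' (p + 1 - j) * (p + 1).choose j / (p + 1) * (n : ℚ) ^ j := by
  have h := sum_Ico_pow n p
  rw [Finset.Ico_add_one_right_eq_Icc] at h
  rw [h]
  refine Finset.sum_nbij' (fun i => p + 1 - i) (fun j => p + 1 - j) ?_ ?_ ?_ ?_ ?_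
  · intro i hi
    simp only [Finset.mem_range, Finset.mem_Icc] at hi ⊢
    omega
  · intro j hj
    simp only [Finset.mem_range, Finset.mem_Icc] at hj ⊢
    omega
  · intro i hi
    simp only [Finset.mem_range] at hi
    omega
  · intro j hj
    simp only [Finset.mem_Icc] at hj
    omega
  · intro i hi
    have hi' : i ≤ p + 1 := (Finset.mem_range.mp hi).le
    rw [Nat.choose_symm hi', Nat.sub_sub_self hi']
    ring

theorem faulhaberCoeff_eq_bernoulli' (p j : ℕ) (hj : 1 ≤ j) (hjp : j ≤ p + 1) :
    faulhaberCoeff p j = bernoulli' (p + 1 - j) * (p + 1).choose j / (p + 1) := by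
  induction p generalizing j with
  | zero =>
    obtain rfl : j = 1 := by omega
    simp [faulhaberCoeff]
  | succ i ih =>
    have step : ∀ k ∈ Finset.Icc 2 (i + 2),
        ((i + 1 : ℚ) / (k : ℚ)) * faulhaberCoeff i (k - 1) =
          bernoulli' (i + 1 + 1 - k) * (i + 1 + 1).choose k / ((i + 1 : ℕ) + 1) := by
      intro k hk
      obtain ⟨hk2, hki⟩ := Finset.mem_Icc.mp hk
      obtain ⟨m, rfl⟩ : ∃ m, k = m + 1 := ⟨k - 1, by omega⟩
      rw [Nat.add_sub_cancel, ih m (by omega) (by omega), Nat.add_sub_add_right]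
      have h : ((i + 1 + 1 : ℕ) : ℚ) * (i + 1).choose m =
          (i + 1 + 1).choose (m + 1) * (m + 1 : ℕ) := by
        exact_mod_cast Nat.add_one_mul_choose_eq (i + 1) m
      push_cast at h ⊢
      field_simp
      linear_combination bernoulli' (i + 1 - m) * h
    by_cases h1 : j = 1
    · subst h1
      have total := sum_Icc_pow_eq_sum_bernoulli' (i + 1) 1
      rw [← Finset.add_sum_Ioc_eq_sum_Icc (b := i + 1 + 1) (by omega), ← Finset.Icc_add_one_left_eq_Ioc] at total
      rw [faulhaberCoeff, if_pos rfl, Finset.sum_congr rfl step]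
      simp at total ⊢
      linarith
    · rw [faulhaberCoeff, if_neg h1, if_pos (by omega),
        step j (Finset.mem_Icc.mpr (by omega))]

theorem direct_algorithm_correct (p : ℕ) (n : ℕ) (hn : 1 ≤ n) :
    ∑ j ∈ Finset.Icc 1 (p + 1), faulhaberCoeff p j * (n : ℚ) ^ j =
      ∑ k ∈ Finset.Icc 1 n, (k : ℚ) ^ p := by
  rw [sum_Icc_pow_eq_sum_bernoulli']
  refine Finset.sum_congr rfl fun j hj => ?_
  obtain ⟨h1, h2⟩ := Finset.mem_Icc.mp hj
  rw [faulhaberCoeff_eq_bernoulli' p j h1 h2]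
end
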